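/- (Sharp threshold for decoding) Let C ⊆ F_q^n be a linear code with minimum distance d_min ≥ 4q, and let g(p) = Pr_{z∼p}[z ∈ Ω] be the ML decoding success probability. Then for any 0 ≤ p_0 ≤ p_1 ≤ 1, g(p_1)·(1 − g(p_0)) ≤ exp(−((1−p_1)/4)·(√d_min / q^{3/2})·(p_1 − p_0)). -/

import Mathlib

open Finset

/-- Expectation of `f` under the q-ary `p`-noisy distribution on `F^n`:
each coordinate is independently `0` with probability `1 - p` and each nonzero
element with probability `p/(q-1)` where `q = |F|`. -/
noncomputable def noisyExpF (F : Type*) [Fintype F] [DecidableEq F] [Zero F] (n : ℕ) (p : ℝ)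
    (f : (Fin n → F) → ℝ) : ℝ :=
  ∑ z : Fin n → F, (∏ i, if z i = 0 then 1 - p else p / ((Fintype.card F : ℝ) - 1)) * f z

/-- The fixed total order `≺` on `F^n`: first compare Hamming weights; ties are
broken so that the vector whose support comes *after* in the lexicographic order
of supports is smaller (i.e. at the first coordinate where the supports differ,
the smaller vector is `0` there); remaining ties are broken by the lexicographic
order on entries. -/
def precRel (F : Type*) [Zero F] [LinearOrder F] {n : ℕ} (a b : Fin n → F) : Prop :=
  hammingNorm a < hammingNorm b ∨
  (hammingNorm a = hammingNorm b ∧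
    ∃ i, a i = 0 ∧ b i ≠ 0 ∧ ∀ j, j < i → (a j = 0 ↔ b j = 0)) ∨
  ((∀ i, a i = 0 ↔ b i = 0) ∧ ∃ i, a i < b i ∧ ∀ j, j < i → a j = b j)

/-- The decoding region `Ω_c` of the codeword `c` for the maximum-likelihood
decoder `D*` determined by the order `≺`: `D*(z) = c` iff `z - c` strictly
precedes `z - c'` for every other codeword `c'`. -/
def decRegion {F : Type*} [Field F] [LinearOrder F] {n : ℕ}
    (C : Submodule F (Fin n → F)) (c : Fin n → F) : Set (Fin n → F) :=
  {z | ∀ c' ∈ C, c' ≠ c → precRel F (z - c) (z - c')}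


section Generic

/-- Product expectation. -/
noncomputable def pE {X : Type*} [Fintype X] (w : X → ℝ) (n : ℕ) (f : (Fin n → X) → ℝ) : ℝ :=
  ∑ z : Fin n → X, (∏ i, w (z i)) * f z

variable {X : Type*} [Fintype X]

lemma pE_mono (w : X → ℝ) (hw : ∀ x, 0 ≤ w x) {n : ℕ} {f g : (Fin n → X) → ℝ}
    (h : ∀ z, f z ≤ g z) : pE w n f ≤ pE w n g :=
  Finset.sum_le_sum fun z _ => mul_le_mul_of_nonneg_left (h z) (Finset.prod_nonneg fun _ _ => hw _)

lemma pE_const (w : X → ℝ) (hs : ∑ x, w x = 1) (n : ℕ) (r : ℝ) : pE w n (fun _ => r) = r := by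
  classical
  unfold pE
  rw [← Finset.sum_mul, ← Fintype.sum_pow, hs, one_pow, one_mul]

lemma pE_const_mul (w : X → ℝ) (n : ℕ) (r : ℝ) (f : (Fin n → X) → ℝ) :
    pE w n (fun z => r * f z) = r * pE w n f := by
  unfold pE
  rw [Finset.mul_sum]
  exact Finset.sum_congr rfl fun z _ => by ring

lemma pE_sub (w : X → ℝ) (n : ℕ) (f g : (Fin n → X) → ℝ) :
    pE w n (fun z => f z - g z) = pE w n f - pE w n g := by
  unfold pE
  rw [← Finset.sum_sub_distrib]
  exact Finset.sum_congr rfl fun z _ => by ring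

lemma pE_add (w : X → ℝ) (n : ℕ) (f g : (Fin n → X) → ℝ) :
    pE w n (fun z => f z + g z) = pE w n f + pE w n g := by
  unfold pE
  rw [← Finset.sum_add_distrib]
  exact Finset.sum_congr rfl fun z _ => by ring

lemma pE_succ (w : X → ℝ) (n : ℕ) (f : (Fin (n+1) → X) → ℝ) :
    pE w (n+1) f = ∑ x, w x * pE w n (fun z => f (Fin.cons x z)) := by
  unfold pE
  rw [← (Fin.consEquiv (fun _ => X)).sum_comp, Fintype.sum_prod_type]
  refine Finset.sum_congr rfl fun x _ => ?_
  rw [Finset.mul_sum]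
  refine Finset.sum_congr rfl fun z _ => ?_
  simp [Fin.consEquiv, Fin.prod_univ_succ, mul_assoc]

lemma pE_mink (w : X → ℝ) (hw : ∀ x, 0 ≤ w x) {n : ℕ} (u v : (Fin n → X) → ℝ) :
    √((pE w n u)^2 + (pE w n v)^2) ≤ pE w n (fun z => √((u z)^2 + (v z)^2)) := by
  set U := pE w n u
  set V := pE w n v
  set R := √(U^2 + V^2) with hR
  have hRR : R * R = U^2 + V^2 := Real.mul_self_sqrt (by positivity)
  have hR0 : 0 ≤ R := Real.sqrt_nonneg _
  have key : R * R ≤ R * pE w n (fun z => √((u z)^2 + (v z)^2)) := by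
    have e : R * R = pE w n (fun z => U * u z + V * v z) := by
      rw [pE_add, pE_const_mul, pE_const_mul, hRR]; ring
    rw [e, ← pE_const_mul]
    refine pE_mono w hw fun z => ?_
    rw [hR, ← Real.sqrt_mul (by positivity)]
    apply Real.le_sqrt_of_sq_le
    nlinarith [sq_nonneg (U * v z - V * u z)]
  rcases hR0.eq_or_lt with h | h
  · rw [← h]
    have : pE w n (fun _ => (0:ℝ)) ≤ pE w n (fun z => √((u z)^2 + (v z)^2)) :=
      pE_mono w hw fun z => Real.sqrt_nonneg _
    simpa [pE] using this
  · exact le_of_mul_le_mul_left key h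

lemma one_dim (w : X → ℝ) (hw : ∀ x, 0 ≤ w x) (hs : ∑ x, w x = 1) (f : X → ℝ)
    (hf0 : ∀ x, 0 ≤ f x) (hf1 : ∀ x, f x ≤ 1) :
    (∑ x, w x * f x) * (1 - ∑ x, w x * f x) ≤
      ∑ x, w x * √((f x * (1 - f x))^2 + (2 * (f x - ⨅ a, f a))^2) := by
  have hne : Nonempty X := by
    by_contra h
    rw [not_nonempty_iff] at h
    simp at hs
  set m := ⨅ a, f a with hm
  have hm0 : 0 ≤ m := le_ciInf hf0
  have hmle : ∀ x, m ≤ f x := fun x => ciInf_le (Set.finite_range f).bddBelow x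
  set g := ∑ x, w x * f x with hg
  have point : ∀ x, f x * (1 - f x) + (f x - m)^2 ≤
      √((f x * (1 - f x))^2 + (2 * (f x - m))^2) := by
    intro x
    apply Real.le_sqrt_of_sq_le
    have h1 := hf0 x
    have h2 := hf1 x
    have h3 := hmle x
    have hJ : f x * (1 - f x) ≤ 1 := by nlinarith
    have hu : (f x - m)^2 ≤ 1 := by nlinarith
    nlinarith [sq_nonneg (f x - m)]
  calc g * (1 - g) ≤ ∑ x, w x * (f x * (1 - f x) + (f x - m)^2) := by
        have : ∑ x, w x * (f x * (1 - f x) + (f x - m)^2) = g - 2 * m * g + m^2 := by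
          have : ∀ x, w x * (f x * (1 - f x) + (f x - m)^2)
              = (1 - 2 * m) * (w x * f x) + m^2 * w x := fun x => by ring
          rw [Finset.sum_congr rfl fun x _ => this x, Finset.sum_add_distrib, ← Finset.mul_sum,
            ← Finset.mul_sum, hs]; ring
        rw [this]; nlinarith [sq_nonneg (g - m)]
    _ ≤ _ := Finset.sum_le_sum fun x _ => mul_le_mul_of_nonneg_left (point x) (hw x)

/-- Bobkov-type functional inequality. -/
lemma bobkov [DecidableEq X] (w : X → ℝ) (hw : ∀ x, 0 ≤ w x) (hs : ∑ x, w x = 1) (n : ℕ) :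
    ∀ (f : (Fin n → X) → ℝ), (∀ z, 0 ≤ f z) → (∀ z, f z ≤ 1) →
    pE w n f * (1 - pE w n f) ≤ pE w n (fun z => √((f z * (1 - f z))^2 +
      ∑ i, (2 * (f z - ⨅ a, f (Function.update z i a)))^2)) := by
  have hne : Nonempty X := by
    by_contra h
    rw [not_nonempty_iff] at h
    simp at hs
  induction n with
  | zero =>
    intro f h0 h1
    simp only [pE, Finset.univ_unique, Finset.sum_singleton, Finset.univ_eq_empty,
      Finset.prod_empty, one_mul, Finset.sum_empty, add_zero]
    exact Real.le_sqrt_of_sq_le le_rfl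
  | succ n ih =>
    intro f h0 h1
    set G : X → ℝ := fun x => pE w n (fun z => f (Fin.cons x z)) with hG
    have hG0 : ∀ x, 0 ≤ G x := fun x => by
      rw [← pE_const w hs n 0]; exact pE_mono w hw fun z => h0 _
    have hG1 : ∀ x, G x ≤ 1 := fun x => by
      rw [← pE_const w hs n 1]; exact pE_mono w hw fun z => h1 _
    rw [pE_succ, pE_succ]
    refine (one_dim w hw hs G hG0 hG1).trans (Finset.sum_le_sum fun x _ =>
      mul_le_mul_of_nonneg_left ?_ (hw x))
    have ihx := ih (fun z => f (Fin.cons x z)) (fun z => h0 _) (fun z => h1 _)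
    set u : (Fin n → X) → ℝ := fun z => √((f (Fin.cons x z) * (1 - f (Fin.cons x z)))^2 +
      ∑ i, (2 * (f (Fin.cons x z) - ⨅ a, f (Fin.cons x (Function.update z i a))))^2) with hu
    set v : (Fin n → X) → ℝ := fun z => 2 * (f (Fin.cons x z) - ⨅ a, f (Fin.cons a z)) with hv
    have hmin : ∀ z a, (⨅ a, f (Fin.cons a z)) ≤ f (Fin.cons a z) := fun z a =>
      ciInf_le (Set.finite_range fun a => f (Fin.cons a z)).bddBelow a
    have hV : 2 * (G x - ⨅ a, G a) ≤ pE w n v := by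
      rw [hv, pE_const_mul, pE_sub]
      have : pE w n (fun z => ⨅ a, f (Fin.cons a z)) ≤ ⨅ a, G a :=
        le_ciInf fun a => pE_mono w hw fun z => hmin z a
      simp only [hG] at *
      linarith
    have hV0 : 0 ≤ 2 * (G x - ⨅ a, G a) := by
      have := ciInf_le (Set.finite_range G).bddBelow x
      linarith
    have hU0 : 0 ≤ G x * (1 - G x) := mul_nonneg (hG0 x) (by linarith [hG1 x])
    calc _ ≤ √((pE w n u)^2 + (pE w n v)^2) := by
          apply Real.sqrt_le_sqrt
          gcongr
      _ ≤ _ := pE_mink w hw u v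
      _ ≤ _ := by
          refine pE_mono w hw fun z => ?_
          apply Real.sqrt_le_sqrt
          rw [Fin.sum_univ_succ, hu]
          simp only
          rw [Real.sq_sqrt (by positivity)]
          simp only [Fin.update_cons_zero, ← Fin.cons_update, hv]
          linarith

lemma resample [DecidableEq X] (w : X → ℝ) (hs : ∑ x, w x = 1) (n : ℕ) (i : Fin n)
    (φ : (Fin n → X) → ℝ) :
    ∑ z : Fin n → X, (∏ j ∈ Finset.univ.erase i, w (z j)) * φ z =
      pE w n (fun z => ∑ a, φ (Function.update z i a)) := by
  have e : ∀ z : Fin n → X, ∏ j, w (z j) = w (z i) * ∏ j ∈ Finset.univ.erase i, w (z j) :=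
    fun z => (Finset.mul_prod_erase _ _ (Finset.mem_univ i)).symm
  have e2 : ∀ (z : Fin n → X) a, ∏ j ∈ Finset.univ.erase i, w (Function.update z i a j)
      = ∏ j ∈ Finset.univ.erase i, w (z j) := fun z a =>
    Finset.prod_congr rfl fun j hj => by rw [Function.update_of_ne (Finset.ne_of_mem_erase hj)]
  unfold pE
  simp only [Finset.mul_sum]
  rw [← Fintype.sum_prod_type' (f := fun (z : Fin n → X) (a : X) =>
    (∏ j, w (z j)) * φ (Function.update z i a))]
  have : ∀ z : Fin n → X, (∏ j ∈ Finset.univ.erase i, w (z j)) * φ z =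
      ∑ a, w a * ((∏ j ∈ Finset.univ.erase i, w (z j)) * φ z) := fun z => by
    rw [← Finset.sum_mul, hs, one_mul]
  rw [Finset.sum_congr rfl fun z _ => this z, ← Fintype.sum_prod_type' (f := fun (z : Fin n → X)
    (a : X) => w a * ((∏ j ∈ Finset.univ.erase i, w (z j)) * φ z))]
  refine Finset.sum_nbij' (fun x => (Function.update x.1 i x.2, x.1 i))
    (fun x => (Function.update x.1 i x.2, x.1 i)) (by simp) (by simp) (by simp) (by simp) ?_
  rintro ⟨z, a⟩ -
  simp only
  rw [e, e2]
  simp [mul_assoc]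

end Generic

section Coding

set_option linter.unusedSectionVars false

variable {F : Type*} [Field F] [Fintype F] [LinearOrder F]

/-- Weight of a symbol. -/
noncomputable def wt (F : Type*) [Field F] [Fintype F] [LinearOrder F] (p : ℝ) (x : F) : ℝ :=
  if x = 0 then 1 - p else p / ((Fintype.card F : ℝ) - 1)

lemma card_gt : (2:ℝ) ≤ Fintype.card F := by
  exact_mod_cast Fintype.one_lt_card (α := F)

lemma noisy_eq (n : ℕ) (p : ℝ) (f : (Fin n → F) → ℝ) : noisyExpF F n p f = pE (wt F p) n f := rfl

lemma wt_nonneg {p : ℝ} (h0 : 0 ≤ p) (h1 : p ≤ 1) (x : F) : 0 ≤ wt F p x := by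
  unfold wt
  have := card_gt (F := F)
  split_ifs
  · linarith
  · exact div_nonneg h0 (by linarith)

lemma sum_ite_zero (a b : ℝ) (f : F → ℝ) :
    ∑ x : F, (if x = 0 then a else b) * f x = (a - b) * f 0 + b * ∑ x, f x := by
  have : ∀ x : F, (if x = 0 then a else b) * f x = (if x = 0 then (a - b) * f 0 else 0) + b * f x := by
    intro x; split_ifs with h
    · subst h; ring
    · ring
  rw [Finset.sum_congr rfl fun x _ => this x, Finset.sum_add_distrib, ← Finset.mul_sum]
  simp

lemma wt_sum (p : ℝ) : ∑ x : F, wt F p x = 1 := by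
  have h := sum_ite_zero (F := F) (1 - p) (p / ((Fintype.card F : ℝ) - 1)) (fun _ => 1)
  simp only [mul_one] at h
  unfold wt
  rw [h]
  have := card_gt (F := F)
  have h' : (Fintype.card F : ℝ) - 1 ≠ 0 := by intro h; linarith
  simp
  field_simp
  ring

/-- Russo-type formula. -/
lemma russo (n : ℕ) (p : ℝ) (f : (Fin n → F) → ℝ) :
    HasDerivAt (fun p => pE (wt F p) n f)
      (-(1 / ((Fintype.card F : ℝ) - 1)) * pE (wt F p) n (fun z => ∑ i, ∑ a,
        (f (Function.update z i 0) - f (Function.update z i a)))) p := by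
  have hc := card_gt (F := F)
  have h' : (Fintype.card F : ℝ) - 1 ≠ 0 := by intro h; linarith
  have hw : ∀ x : F, HasDerivAt (fun p => wt F p x)
      (if x = 0 then -1 else 1 / ((Fintype.card F : ℝ) - 1)) p := by
    intro x
    unfold wt
    split_ifs
    · simpa using (hasDerivAt_id p).const_sub 1
    · simpa using (hasDerivAt_id p).div_const ((Fintype.card F : ℝ) - 1)
  have hd : HasDerivAt (fun p => pE (wt F p) n f)
      (∑ z : Fin n → F, (∑ i, (∏ j ∈ Finset.univ.erase i, wt F p (z j)) •
        (if z i = 0 then -1 else 1 / ((Fintype.card F : ℝ) - 1))) * f z) p := by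
    unfold pE
    refine HasDerivAt.fun_sum fun z _ => ?_
    exact (HasDerivAt.fun_finsetProd fun i _ => hw (z i)).mul_const (f z)
  convert hd using 1
  simp only [smul_eq_mul, Finset.sum_mul]
  rw [Finset.sum_comm]
  have : ∀ i : Fin n, ∑ z : Fin n → F, (∏ j ∈ Finset.univ.erase i, wt F p (z j)) *
        (if z i = 0 then -1 else 1 / ((Fintype.card F : ℝ) - 1)) * f z =
        -(1 / ((Fintype.card F : ℝ) - 1)) * pE (wt F p) n (fun z => ∑ a,
        (f (Function.update z i 0) - f (Function.update z i a))) := by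
    intro i
    have := resample (wt F p) (wt_sum p) n i
      (fun z => (if z i = 0 then -1 else 1 / ((Fintype.card F : ℝ) - 1)) * f z)
    simp only [mul_assoc]
    rw [this, ← pE_const_mul]
    congr 1
    funext z
    simp only [Function.update_self]
    rw [sum_ite_zero _ _ (fun a => f (Function.update z i a))]
    simp
    field_simp
    ring
  rw [Finset.sum_congr rfl fun i _ => this i, ← Finset.mul_sum]
  congr 1
  unfold pE
  rw [Finset.sum_comm]
  exact Finset.sum_congr rfl fun z _ => by rw [Finset.mul_sum]

/-- Single-coordinate difference. -/
def dl (x y : F) : ℤ := (if x = y then 0 else 1) - (if x = 0 then 0 else 1)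

/-- `|z - c| - |z|`. -/
def dif {n : ℕ} (z c : Fin n → F) : ℤ := ∑ j, dl (z j) (c j)

lemma dif_eq {n : ℕ} (z c : Fin n → F) :
    dif z c = (hammingNorm (z - c) : ℤ) - hammingNorm z := by
  unfold dif dl hammingNorm
  rw [Finset.sum_sub_distrib, Finset.card_filter, Finset.card_filter]
  push_cast
  simp [sub_eq_zero]

lemma dif_update {n : ℕ} (z c : Fin n → F) (i : Fin n) (a : F) :
    dif (Function.update z i a) c = dif z c - dl (z i) (c i) + dl a (c i) := by
  unfold dif
  rw [← Finset.add_sum_erase _ _ (Finset.mem_univ i),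
    ← Finset.add_sum_erase (a := i) _ (fun j => dl (z j) (c j)) (Finset.mem_univ i)]
  have : ∑ j ∈ Finset.univ.erase i, dl (Function.update z i a j) (c j) =
      ∑ j ∈ Finset.univ.erase i, dl (z j) (c j) :=
    Finset.sum_congr rfl fun j hj => by rw [Function.update_of_ne (Finset.ne_of_mem_erase hj)]
  rw [this]; simp only [Function.update_self]; ring

lemma dl_zero_ge (x y : F) : dl x y ≤ dl 0 y := by
  unfold dl
  split_ifs <;> simp_all

lemma dl_le (x y : F) : dl x y ≤ 1 := by
  unfold dl
  split_ifs <;> simp_all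

lemma dl_ge (x y : F) : -1 ≤ dl x y := by
  unfold dl
  split_ifs <;> simp_all

lemma dl_sum (x y : F) : ∑ l : F, dl x (l * y) =
    if y = 0 then 0 else if x = 0 then (Fintype.card F : ℤ) - 1 else -1 := by
  unfold dl
  by_cases h1 : y = 0
  · simp [h1, eq_comm]
  rw [if_neg h1]
  have hiff : ∀ l : F, x = l * y ↔ l = x / y := fun l => by rw [eq_div_iff h1, eq_comm]
  simp only [hiff]
  have : ∀ l : F, (if l = x / y then 0 else 1 : ℤ) = 1 - if l = x / y then 1 else 0 := by
    intro l; split_ifs <;> simp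
  simp only [this, Finset.sum_sub_distrib, Finset.sum_ite_eq', Finset.sum_const,
    Finset.mem_univ, if_true, Finset.card_univ, nsmul_eq_mul]
  split_ifs <;> ring

/-- Weak decoding region. -/
def wkReg {n : ℕ} (C : Submodule F (Fin n → F)) : Set (Fin n → F) :=
  {z | ∀ c ∈ C, 0 ≤ dif z c}

lemma wk_mono {n : ℕ} (C : Submodule F (Fin n → F)) {z : Fin n → F} (hz : z ∈ wkReg C)
    (i : Fin n) : Function.update z i 0 ∈ wkReg C := by
  intro c hc
  have := hz c hc
  rw [dif_update]
  have := dl_zero_ge (z i) (c i)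
  omega

lemma prec_norm {n : ℕ} {a b : Fin n → F} (h : precRel F a b) : hammingNorm a ≤ hammingNorm b := by
  rcases h with h | h | h
  · exact h.le
  · exact h.1.le
  · apply le_of_eq
    unfold hammingNorm
    congr 1
    ext i
    simp [h.1 i]

lemma dec_sub_wk {n : ℕ} (C : Submodule F (Fin n → F)) {z : Fin n → F} (hz : z ∈ decRegion C 0) :
    z ∈ wkReg C := by
  intro c hc
  by_cases h : c = 0
  · subst h; simp [dif_eq]
  · have := prec_norm (hz c hc h)
    rw [dif_eq]
    simp at this
    omega

lemma not_dec {n : ℕ} (C : Submodule F (Fin n → F)) {z : Fin n → F} (hz : z ∈ wkReg C)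
    (hz' : z ∉ decRegion C 0) : ∃ c ∈ C, c ≠ 0 ∧ dif z c = 0 := by
  simp only [decRegion, Set.mem_ofPred_eq, not_forall] at hz'
  obtain ⟨c, hc, hc0, h⟩ := hz'
  refine ⟨c, hc, hc0, le_antisymm ?_ (hz c hc)⟩
  rw [dif_eq]
  by_contra h2
  apply h
  left
  simp
  omega

lemma norm_update {n : ℕ} (z : Fin n → F) (i : Fin n) (hi : z i ≠ 0) :
    hammingNorm (Function.update z i 0) + 1 = hammingNorm z := by
  unfold hammingNorm
  have : (Finset.univ.filter fun j => Function.update z i 0 j ≠ 0) =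
      (Finset.univ.filter fun j => z j ≠ 0).erase i := by
    ext j
    by_cases h : j = i
    · subst h; simp
    · simp [h]
  rw [this, Finset.card_erase_add_one]
  simp [hi]

lemma dec_mono {n : ℕ} (C : Submodule F (Fin n → F)) {z : Fin n → F} (hz : z ∈ decRegion C 0)
    (i : Fin n) : Function.update z i 0 ∈ decRegion C 0 := by
  by_cases hi : z i = 0
  · rwa [← hi, Function.update_eq_self]
  intro c hc hc0
  have hp := hz c hc hc0
  rw [sub_zero] at hp ⊢
  by_cases hci : c i = 0
  · have e : Function.update z i 0 - c = Function.update (z - c) i 0 := by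
      ext j
      by_cases h : j = i
      · subst h; simp [hci]
      · simp [h]
    have n1 := norm_update z i hi
    have n2 := norm_update (z - c) i (by simpa [hci] using hi)
    rw [e]
    have same : z i = (z - c) i := by simp [hci]
    generalize z - c = y at *
    have hi' : y i ≠ 0 := same ▸ hi
    have iff_of : ∀ j, (z j = 0 ↔ y j = 0) → (Function.update z i 0 j = 0 ↔
        Function.update y i 0 j = 0) := by
      intro j hj
      by_cases h : j = i
      · subst h; simp
      · simpa [h] using hj
    have eq_of : ∀ j, z j = y j → Function.update z i 0 j = Function.update y i 0 j := by
      intro j hj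
      by_cases h : j = i
      · subst h; simp
      · simpa [h] using hj
    rcases hp with h | ⟨h, k, hk1, hk2, hk3⟩ | ⟨h, k, hk1, hk2⟩
    · left; omega
    · right; left
      have hk : k ≠ i := by rintro rfl; exact hi hk1
      exact ⟨by omega, k, by simpa [hk] using hk1, by simpa [hk] using hk2,
        fun j hj => iff_of j (hk3 j hj)⟩
    · right; right
      have hk : k ≠ i := by rintro rfl; exact hk1.ne same
      exact ⟨fun j => iff_of j (h j), k, by simpa [hk] using hk1,
        fun j hj => eq_of j (hk2 j hj)⟩
  · left
    have h1 := prec_norm hp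
    have h2 := dif_update z c i 0
    rw [dif_eq, dif_eq] at h2
    have h3 : dl (z i) (c i) ≤ 0 := by unfold dl; simp only [hi, if_false]; split_ifs <;> simp
    have h4 : dl 0 (c i) = 1 := by unfold dl; simp [Ne.symm hci]
    have h5 := norm_update z i hi
    omega

/-- Positions where `z` vanishes but `c` does not. -/
def posA {n : ℕ} (z c : Fin n → F) : Finset (Fin n) :=
  Finset.univ.filter fun j => c j ≠ 0 ∧ z j = 0

lemma card_posA {n : ℕ} (C : Submodule F (Fin n → F)) {z : Fin n → F} (hz : z ∈ wkReg C)
    {c : Fin n → F} (hc : c ∈ C) : hammingNorm c ≤ Fintype.card F * (posA z c).card := by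
  have h : 0 ≤ ∑ l : F, dif z (l • c) :=
    Finset.sum_nonneg fun l _ => hz _ (C.smul_mem l hc)
  unfold dif at h
  rw [Finset.sum_comm] at h
  simp only [Pi.smul_apply, smul_eq_mul, dl_sum] at h
  have e : ∀ j, (if c j = 0 then 0 else if z j = 0 then (Fintype.card F : ℤ) - 1 else -1) =
      (Fintype.card F : ℤ) * (if c j ≠ 0 ∧ z j = 0 then 1 else 0) - if c j ≠ 0 then 1 else 0 := by
    intro j
    by_cases h1 : c j = 0 <;> by_cases h2 : z j = 0 <;> simp [h1, h2]
  rw [Finset.sum_congr rfl fun j _ => e j, Finset.sum_sub_distrib, ← Finset.mul_sum] at h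
  unfold hammingNorm posA
  rw [Finset.card_filter, Finset.card_filter]
  zify
  linarith


lemma ind_vals {n : ℕ} (S : Set (Fin n → F)) (z : Fin n → F) :
    0 ≤ S.indicator (1 : (Fin n → F) → ℝ) z ∧ S.indicator (1 : (Fin n → F) → ℝ) z ≤ 1 := by
  classical
  rw [Set.indicator_apply]
  split_ifs <;> simp

/-- Total boundary. -/
noncomputable def bd {n : ℕ} (S : Set (Fin n → F)) (z : Fin n → F) : ℝ :=
  ∑ i, ∑ a, (S.indicator (1 : (Fin n → F) → ℝ) (Function.update z i 0) -
    S.indicator (1 : (Fin n → F) → ℝ) (Function.update z i a))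

lemma bd_term {n : ℕ} (S : Set (Fin n → F)) (hS : ∀ z ∈ S, ∀ i, Function.update z i 0 ∈ S)
    (z : Fin n → F) (i : Fin n) (a : F) :
    0 ≤ S.indicator (1 : (Fin n → F) → ℝ) (Function.update z i 0) -
    S.indicator (1 : (Fin n → F) → ℝ) (Function.update z i a) := by
  by_cases h : Function.update z i a ∈ S
  · have := hS _ h i
    rw [Function.update_idem] at this
    simp [h, this]
  · have := (ind_vals S (Function.update z i 0)).1
    simpa [h] using this

lemma bd_nonneg {n : ℕ} (S : Set (Fin n → F)) (hS : ∀ z ∈ S, ∀ i, Function.update z i 0 ∈ S)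
    (z : Fin n → F) : 0 ≤ bd S z :=
  Finset.sum_nonneg fun _ _ => Finset.sum_nonneg fun _ _ => bd_term S hS _ _ _

lemma pE_nonneg {n : ℕ} {p : ℝ} (h0 : 0 ≤ p) (h1 : p ≤ 1) {f : (Fin n → F) → ℝ}
    (hf : ∀ z, 0 ≤ f z) : 0 ≤ pE (wt F p) n f := by
  rw [← pE_const (wt F p) (wt_sum p) n 0]
  exact pE_mono _ (wt_nonneg h0 h1) hf

lemma pE_le_one {n : ℕ} {p : ℝ} (h0 : 0 ≤ p) (h1 : p ≤ 1) {f : (Fin n → F) → ℝ}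
    (hf : ∀ z, f z ≤ 1) : pE (wt F p) n f ≤ 1 := by
  rw [← pE_const (wt F p) (wt_sum p) n 1]
  exact pE_mono _ (wt_nonneg h0 h1) hf

/-- Success probability of a region. -/
noncomputable def pr {n : ℕ} (S : Set (Fin n → F)) (p : ℝ) : ℝ :=
  pE (wt F p) n (S.indicator 1)

lemma pr_deriv {n : ℕ} (S : Set (Fin n → F)) (p : ℝ) : HasDerivAt (pr S)
    (-(1 / ((Fintype.card F : ℝ) - 1)) * pE (wt F p) n (bd S)) p :=
  russo n p _

lemma pr_anti {n : ℕ} (S : Set (Fin n → F)) (hS : ∀ z ∈ S, ∀ i, Function.update z i 0 ∈ S) :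
    AntitoneOn (pr S) (Set.Icc 0 1) := by
  apply antitoneOn_of_deriv_nonpos (convex_Icc 0 1)
  · exact fun x _ => (pr_deriv S x).continuousAt.continuousWithinAt
  · exact fun x _ => (pr_deriv S x).differentiableAt.differentiableWithinAt
  · intro x hx
    rw [interior_Icc] at hx
    rw [(pr_deriv S x).deriv]
    have hc := card_gt (F := F)
    have : 0 ≤ 1 / ((Fintype.card F : ℝ) - 1) := by
      apply div_nonneg <;> linarith
    have h2 := pE_nonneg hx.1.le hx.2.le (bd_nonneg S hS)
    nlinarith [mul_nonneg this h2]

lemma exit_zero {n : ℕ} (C : Submodule F (Fin n → F)) {z c : Fin n → F} (hc : c ∈ C)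
    (h : dif z c ≤ 0) {j : Fin n} (hj : j ∈ posA z c) {a : F} (ha : a ≠ 0) :
    Function.update z j a ∉ wkReg C := by
  intro hm
  have := hm c hc
  simp only [posA, Finset.mem_filter, Finset.mem_univ, true_and] at hj
  rw [dif_update] at this
  have h4 : dl (z j) (c j) = 1 := by rw [hj.2]; unfold dl; simp [Ne.symm hj.1]
  have h3 : dl a (c j) ≤ 0 := by unfold dl; simp only [ha, if_false]; split_ifs <;> simp
  omega

lemma exit_one {n : ℕ} (C : Submodule F (Fin n → F)) {z c : Fin n → F} (hc : c ∈ C)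
    (h : dif z c ≤ 1) {j : Fin n} (hj : j ∈ posA z c) :
    Function.update z j (c j) ∉ wkReg C := by
  intro hm
  have := hm c hc
  simp only [posA, Finset.mem_filter, Finset.mem_univ, true_and] at hj
  rw [dif_update] at this
  have h4 : dl (z j) (c j) = 1 := by rw [hj.2]; unfold dl; simp [Ne.symm hj.1]
  have h3 : dl (c j) (c j) = -1 := by unfold dl; simp [hj.1]
  omega

lemma bd_tie {n : ℕ} (C : Submodule F (Fin n → F)) (dmin : ℕ)
    (hdmin : ∀ c ∈ C, c ≠ 0 → dmin ≤ hammingNorm c) (z : Fin n → F) :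
    ((Fintype.card F : ℝ) - 1) * ((dmin : ℝ) / Fintype.card F *
      ((wkReg C).indicator (1 : (Fin n → F) → ℝ) z -
        (decRegion C 0).indicator (1 : (Fin n → F) → ℝ) z)) ≤ bd (wkReg C) z := by
  have hS : ∀ z ∈ wkReg C, ∀ i, Function.update z i 0 ∈ wkReg C := fun z hz i => wk_mono C hz i
  have h0 := bd_nonneg _ hS z
  by_cases h1 : z ∈ decRegion C 0
  · simpa [h1, dec_sub_wk C h1] using h0
  by_cases h2 : z ∈ wkReg C
  swap
  · simpa [h1, h2] using h0
  obtain ⟨c, hc, hc0, hd⟩ := not_dec C h2 h1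
  have hcard := card_gt (F := F)
  have hA : (dmin : ℝ) / Fintype.card F ≤ (posA z c).card := by
    rw [div_le_iff₀ (by linarith), mul_comm]
    exact_mod_cast (hdmin c hc hc0).trans (card_posA C h2 hc)
  have hsum : ((posA z c).card : ℝ) * ((Fintype.card F : ℝ) - 1) ≤ bd (wkReg C) z := by
    unfold bd
    rw [← nsmul_eq_mul, ← Finset.sum_const]
    refine le_trans (Finset.sum_le_sum (f := fun _ => (Fintype.card F : ℝ) - 1) (g := fun i => ∑ a,
      ((wkReg C).indicator (1 : (Fin n → F) → ℝ) (Function.update z i 0) -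
    (wkReg C).indicator (1 : (Fin n → F) → ℝ) (Function.update z i a))) fun j hj => ?_)
      (Finset.sum_le_sum_of_subset_of_nonneg (Finset.subset_univ _) fun i _ _ =>
        Finset.sum_nonneg fun a _ => bd_term _ hS z i a)
    rw [← Finset.add_sum_erase _ _ (Finset.mem_univ (0:F))]
    have : ∀ a ∈ Finset.univ.erase (0:F),
        ((wkReg C).indicator (1 : (Fin n → F) → ℝ) (Function.update z j 0) -
    (wkReg C).indicator (1 : (Fin n → F) → ℝ) (Function.update z j a)) = 1 := by
      intro a ha
      have := exit_zero C hc hd.le hj (Finset.ne_of_mem_erase ha)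
      simp [this, wk_mono C h2 j]
    rw [Finset.sum_congr rfl this]
    simp [Finset.card_erase_of_mem, Nat.cast_sub (Fintype.card_pos (α := F))]
  simp only [h1, h2, not_false_eq_true, Set.indicator_of_mem, Set.indicator_of_notMem,
    Pi.one_apply, sub_zero, mul_one]
  nlinarith

lemma bd_iso {n : ℕ} (C : Submodule F (Fin n → F)) (dmin : ℕ)
    (hdmin : ∀ c ∈ C, c ≠ 0 → dmin ≤ hammingNorm c) (z : Fin n → F) :
    √((dmin : ℝ) / Fintype.card F) * √(∑ i, ((wkReg C).indicator (1 : (Fin n → F) → ℝ) z -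
        ⨅ a, (wkReg C).indicator (1 : (Fin n → F) → ℝ) (Function.update z i a))^2)
      ≤ bd (wkReg C) z := by
  have hS : ∀ z ∈ wkReg C, ∀ i, Function.update z i 0 ∈ wkReg C := fun z hz i => wk_mono C hz i
  have h0 := bd_nonneg _ hS z
  set f := (wkReg C).indicator (1 : (Fin n → F) → ℝ) with hf
  have hcard := card_gt (F := F)
  have hile : ∀ i a, (⨅ a, f (Function.update z i a)) ≤ f (Function.update z i a) := fun i a =>
    ciInf_le (Set.finite_range fun a => f (Function.update z i a)).bddBelow a
  have hi0 : ∀ i, 0 ≤ ⨅ a, f (Function.update z i a) := fun i => le_ciInf fun a => (ind_vals _ _).1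
  by_cases h2 : z ∈ wkReg C
  swap
  · have e : ∀ i, (f z - ⨅ a, f (Function.update z i a)) = 0 := by
      intro i
      have h1 := hile i (z i)
      rw [Function.update_eq_self] at h1
      have h3 : f z = 0 := by simp [hf, h2]
      linarith [hi0 i]
    simpa [e] using h0
  have hz1 : f z = 1 := by simp [hf, h2]
  -- exits
  have hex1 : ∀ i a, Function.update z i a ∉ wkReg C →
      f z - (⨅ a, f (Function.update z i a)) = 1 := by
    intro i a ha
    have h1 := hile i a
    have h3 : f (Function.update z i a) = 0 := by simp [hf, ha]
    linarith [hi0 i]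
  have hex0 : ∀ i, (∀ a, Function.update z i a ∈ wkReg C) →
      f z - (⨅ a, f (Function.update z i a)) = 0 := by
    intro i h
    have : ∀ a, f (Function.update z i a) = 1 := fun a => by simp [hf, h a]
    simp [this, hz1]
  by_cases hb : ∃ i a, Function.update z i a ∉ wkReg C
  swap
  · push Not at hb
    simpa [fun i => hex0 i (hb i)] using h0
  obtain ⟨i, a, hia⟩ := hb
  have : ∃ c ∈ C, dif (Function.update z i a) c < 0 := by
    by_contra h; push Not at h; exact hia h
  obtain ⟨c, hc, hneg⟩ := this
  have hd1 : dif z c ≤ 1 := by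
    rw [dif_update] at hneg
    have := dl_le (z i) (c i)
    have := dl_ge a (c i)
    omega
  have hc0 : c ≠ 0 := by
    rintro rfl
    simp [dif_eq] at hneg
  have hA : (dmin : ℝ) / Fintype.card F ≤ (posA z c).card := by
    rw [div_le_iff₀ (by linarith), mul_comm]
    exact_mod_cast (hdmin c hc hc0).trans (card_posA C h2 hc)
  set H := ∑ i, (f z - ⨅ a, f (Function.update z i a))^2 with hH
  have hAH : ((posA z c).card : ℝ) ≤ H := by
    have : ((posA z c).card : ℝ) = ∑ i ∈ posA z c, (f z - ⨅ a, f (Function.update z i a))^2 := by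
      rw [Finset.sum_congr rfl fun j hj => by rw [hex1 j _ (exit_one C hc hd1 hj)]]
      simp
    rw [this]
    exact Finset.sum_le_sum_of_subset_of_nonneg (Finset.subset_univ _) fun i _ _ => sq_nonneg _
  have hHb : H ≤ bd (wkReg C) z := by
    refine Finset.sum_le_sum fun i _ => ?_
    by_cases h : ∀ a, Function.update z i a ∈ wkReg C
    · rw [hex0 i h, zero_pow two_ne_zero]
      exact Finset.sum_nonneg fun a _ => bd_term _ hS z i a
    · push Not at h
      obtain ⟨a, ha⟩ := h
      rw [hex1 i a ha]
      refine le_trans ?_ (Finset.single_le_sum (fun a _ => bd_term _ hS z i a) (Finset.mem_univ a))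
      simp [ha, wk_mono C h2 i]
  calc _ ≤ √H * √H := by
        gcongr
        exact hA.trans hAH
    _ = H := Real.mul_self_sqrt (Finset.sum_nonneg fun i _ => sq_nonneg _)
    _ ≤ _ := hHb

lemma wk_diff {n : ℕ} (C : Submodule F (Fin n → F)) (dmin : ℕ)
    (hdmin : ∀ c ∈ C, c ≠ 0 → dmin ≤ hammingNorm c) {p : ℝ} (h0 : 0 ≤ p) (h1 : p ≤ 1) :
    -(1 / ((Fintype.card F : ℝ) - 1)) * pE (wt F p) n (bd (wkReg C)) ≤
      -(√((dmin : ℝ) / Fintype.card F) / (2 * Fintype.card F)) *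
        (pr (wkReg C) p * (1 - pr (wkReg C) p)) := by
  have hcard := card_gt (F := F)
  set f := (wkReg C).indicator (1 : (Fin n → F) → ℝ) with hf
  have hb := bobkov (wt F p) (wt_nonneg h0 h1) (wt_sum p) n f
    (fun z => (ind_vals _ z).1) (fun z => (ind_vals _ z).2)
  set s := √((dmin : ℝ) / Fintype.card F) with hs
  have hs0 : 0 ≤ s := Real.sqrt_nonneg _
  have hB0 : 0 ≤ pE (wt F p) n (bd (wkReg C)) :=
    pE_nonneg h0 h1 (bd_nonneg _ fun z hz i => wk_mono C hz i)
  have key : s * (pr (wkReg C) p * (1 - pr (wkReg C) p)) ≤ 2 * pE (wt F p) n (bd (wkReg C)) := by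
    refine (mul_le_mul_of_nonneg_left hb hs0).trans ?_
    rw [← pE_const_mul, ← pE_const_mul]
    refine pE_mono _ (wt_nonneg h0 h1) fun z => ?_
    have e : f z * (1 - f z) = 0 := by
      by_cases h : z ∈ wkReg C <;> simp [hf, h]
    rw [e]
    simp only [mul_pow]
    rw [← Finset.mul_sum, zero_pow two_ne_zero, zero_add, Real.sqrt_mul (by positivity),
      Real.sqrt_sq (by norm_num)]
    have := bd_iso C dmin hdmin z
    linarith
  have h2 : s / (2 * Fintype.card F) * (pr (wkReg C) p * (1 - pr (wkReg C) p)) ≤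
      1 / (Fintype.card F : ℝ) * pE (wt F p) n (bd (wkReg C)) := by
    have : s / (2 * Fintype.card F) * (pr (wkReg C) p * (1 - pr (wkReg C) p)) =
      1 / (Fintype.card F : ℝ) * ((s * (pr (wkReg C) p * (1 - pr (wkReg C) p))) / 2) := by
      field_simp
    rw [this]
    gcongr
    linarith
  have h3 : 1 / (Fintype.card F : ℝ) * pE (wt F p) n (bd (wkReg C)) ≤
      1 / ((Fintype.card F : ℝ) - 1) * pE (wt F p) n (bd (wkReg C)) := by
    apply mul_le_mul_of_nonneg_right _ hB0
    apply one_div_le_one_div_of_le <;> linarith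
  linarith

lemma wk_tie {n : ℕ} (C : Submodule F (Fin n → F)) (dmin : ℕ)
    (hdmin : ∀ c ∈ C, c ≠ 0 → dmin ≤ hammingNorm c) {p : ℝ} (h0 : 0 ≤ p) (h1 : p ≤ 1) :
    -(1 / ((Fintype.card F : ℝ) - 1)) * pE (wt F p) n (bd (wkReg C)) ≤
      -((dmin : ℝ) / Fintype.card F) * (pr (wkReg C) p - pr (decRegion C 0) p) := by
  have hcard := card_gt (F := F)
  have hq : 0 < (Fintype.card F : ℝ) - 1 := by linarith
  have := pE_mono (wt F p) (wt_nonneg h0 h1) (bd_tie C dmin hdmin)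
  rw [pE_const_mul, pE_const_mul, pE_sub] at this
  change _ * (_ * (pr (wkReg C) p - pr (decRegion C 0) p)) ≤ _ at this
  have h := div_le_div_of_nonneg_right this hq.le
  rw [mul_div_cancel_left₀ _ hq.ne'] at h
  have e : pE (wt F p) n (bd (wkReg C)) / ((Fintype.card F : ℝ) - 1) =
    (1 / ((Fintype.card F : ℝ) - 1)) * pE (wt F p) n (bd (wkReg C)) := by ring
  rw [e] at h
  linarith

end Coding

lemma ode_bound (a a' : ℝ → ℝ) (K s t : ℝ) (hst : s ≤ t)
    (hd : ∀ x, HasDerivAt a (a' x) x) (h0 : ∀ x ∈ Set.Icc s t, 0 ≤ a x)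
    (h1 : ∀ x ∈ Set.Icc s t, a x ≤ 1) (hanti : AntitoneOn a (Set.Icc s t))
    (hode : ∀ x ∈ Set.Icc s t, a' x ≤ -K * (a x * (1 - a x))) :
    a t * (1 - a s) ≤ Real.exp (-K * (t - s)) := by
  have ms : s ∈ Set.Icc s t := ⟨le_rfl, hst⟩
  have mt : t ∈ Set.Icc s t := ⟨hst, le_rfl⟩
  rcases (h0 t mt).eq_or_lt with ht | ht
  · rw [← ht, zero_mul]; positivity
  rcases (h1 s ms).eq_or_lt with hs | hs
  · rw [hs, sub_self, mul_zero]; positivity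
  have hp : ∀ x ∈ Set.Icc s t, 0 < a x := fun x hx => ht.trans_le (hanti hx mt hx.2)
  have hl : ∀ x ∈ Set.Icc s t, 0 < 1 - a x := fun x hx => by
    have := hanti ms hx hx.1
    linarith
  have hG : ∀ x ∈ Set.Icc s t, HasDerivAt (fun x => Real.log (a x) - Real.log (1 - a x) + K * x)
      (a' x / a x - (-a' x) / (1 - a x) + K * 1) x := fun x hx =>
    (((hd x).log (hp x hx).ne').sub (((hd x).const_sub 1).log (hl x hx).ne')).add
      ((hasDerivAt_id x).const_mul K)
  have hA : AntitoneOn (fun x => Real.log (a x) - Real.log (1 - a x) + K * x) (Set.Icc s t) := by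
    apply antitoneOn_of_deriv_nonpos (convex_Icc s t)
    · exact fun x hx => (hG x hx).continuousAt.continuousWithinAt
    · exact fun x hx => (hG x (interior_subset hx)).differentiableAt.differentiableWithinAt
    · intro x hx
      have hx := interior_subset hx
      rw [(hG x hx).deriv]
      have p1 := hp x hx
      have p2 := hl x hx
      have e : a' x / a x - (-a' x) / (1 - a x) + K * 1 = (a' x + K * (a x * (1 - a x))) /
          (a x * (1 - a x)) := by field_simp; ring
      rw [e]
      apply div_nonpos_of_nonpos_of_nonneg _ (by positivity)
      linarith [hode x hx]
  have h := hA ms mt hst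
  simp only at h
  have p1 := hp t mt
  have p2 := hl t mt
  have p3 := hp s ms
  have p4 := hl s ms
  rw [← Real.log_le_iff_le_exp (by positivity), Real.log_mul p1.ne' p4.ne']
  have n1 : Real.log (a s) ≤ 0 := Real.log_nonpos p3.le (h1 s ms)
  have n2 : Real.log (1 - a t) ≤ 0 := Real.log_nonpos p2.le (by linarith)
  linarith


/-- Sharp threshold for ML decoding: for `0 ≤ p₀ ≤ p₁ ≤ 1`,
`g(p₁)(1 − g(p₀)) ≤ exp(−((1−p₁)/4)·(√d_min/q^{3/2})·(p₁−p₀))`. -/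
theorem stmt9 {F : Type*} [Field F] [Fintype F] [LinearOrder F] (n : ℕ)
    (C : Submodule F (Fin n → F)) (dmin : ℕ)
    (hdmin : ∀ c ∈ C, c ≠ 0 → dmin ≤ hammingNorm c)
    (h4q : 4 * Fintype.card F ≤ dmin)
    (p₀ p₁ : ℝ) (h0 : 0 ≤ p₀) (h01 : p₀ ≤ p₁) (h1 : p₁ ≤ 1) :
    noisyExpF F n p₁ ((decRegion C 0).indicator 1) *
        (1 - noisyExpF F n p₀ ((decRegion C 0).indicator 1)) ≤
      Real.exp (-((1 - p₁) / 4) * (Real.sqrt dmin / (Fintype.card F : ℝ) ^ ((3:ℝ)/2)) *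
        (p₁ - p₀)) := by
  rw [noisy_eq, noisy_eq]
  change pr (decRegion C 0) p₁ * (1 - pr (decRegion C 0) p₀) ≤ _
  have hcard := card_gt (F := F)
  set q : ℝ := (Fintype.card F : ℝ) with hq
  have hq0 : 0 < q := by linarith
  have hdq : 4 * q ≤ (dmin : ℝ) := by rw [hq]; exact_mod_cast h4q
  have hd0 : 0 < (dmin : ℝ) := by linarith
  set g := pr (decRegion C 0) with hg
  set a := pr (wkReg C) with ha
  have hganti : AntitoneOn g (Set.Icc 0 1) := pr_anti _ fun z hz i => dec_mono C hz i
  have haanti : AntitoneOn a (Set.Icc 0 1) := pr_anti _ fun z hz i => wk_mono C hz i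
  have ha0 : ∀ x ∈ Set.Icc (0:ℝ) 1, 0 ≤ a x := fun x hx =>
    pE_nonneg hx.1 hx.2 fun z => (ind_vals _ z).1
  have ha1 : ∀ x ∈ Set.Icc (0:ℝ) 1, a x ≤ 1 := fun x hx =>
    pE_le_one hx.1 hx.2 fun z => (ind_vals _ z).2
  have hg0 : ∀ x ∈ Set.Icc (0:ℝ) 1, 0 ≤ g x := fun x hx =>
    pE_nonneg hx.1 hx.2 fun z => (ind_vals _ z).1
  have hg1 : ∀ x ∈ Set.Icc (0:ℝ) 1, g x ≤ 1 := fun x hx =>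
    pE_le_one hx.1 hx.2 fun z => (ind_vals _ z).2
  have hga : ∀ x ∈ Set.Icc (0:ℝ) 1, g x ≤ a x := fun x hx =>
    pE_mono _ (wt_nonneg hx.1 hx.2) fun z => by
      by_cases h : z ∈ decRegion C 0
      · simp [h, dec_sub_wk C h]
      · simpa [h] using (ind_vals (wkReg C) z).1
  have m0 : p₀ ∈ Set.Icc (0:ℝ) 1 := ⟨h0, h01.trans h1⟩
  have m1 : p₁ ∈ Set.Icc (0:ℝ) 1 := ⟨h0.trans h01, h1⟩
  set B : ℝ := √(dmin : ℝ) / q ^ ((3:ℝ)/2) with hB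
  have hB0 : 0 ≤ B := by positivity
  have hBeq : √((dmin : ℝ) / q) / (2 * q) = B / 2 := by
    have : q ^ ((3:ℝ)/2) = √q * q := by
      rw [Real.sqrt_eq_rpow, show (3:ℝ)/2 = 1/2 + 1 by norm_num, Real.rpow_add hq0, Real.rpow_one]
    rw [hB, this, Real.sqrt_div hd0.le]
    have : 0 < √q := Real.sqrt_pos.mpr hq0
    field_simp
  set K : ℝ := (1 - p₁) / 4 * B with hK
  have hK0 : 0 ≤ K := mul_nonneg (by linarith) hB0
  have hKB : 2 * K ≤ B / 2 := by
    rw [hK]; nlinarith [m1.1]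
  have hexp : -((1 - p₁) / 4) * B * (p₁ - p₀) = -(K * (p₁ - p₀)) := by rw [hK]; ring
  rw [hexp]
  by_cases hsmall : K * (p₁ - p₀) ≤ 5/4
  · -- trivial range
    have h4 : g p₁ * (1 - g p₀) ≤ 1/4 := by
      have := hganti m0 m1 h01
      nlinarith [hg0 p₁ m1, hg1 p₀ m0, sq_nonneg (g p₁ - 1/2)]
    refine h4.trans ?_
    have : Real.exp (-(5/4)) ≤ Real.exp (-(K * (p₁ - p₀))) := Real.exp_le_exp.mpr (by linarith)
    refine le_trans ?_ this
    rw [Real.exp_neg, ← one_div]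
    apply one_div_le_one_div_of_le (Real.exp_pos _)
    have e1 : Real.exp (5/4) = Real.exp (1/4) * Real.exp 1 := by rw [← Real.exp_add]; norm_num
    have e2 := Real.exp_one_lt_d9
    have e3 : Real.exp (1/4) ≤ 4/3 := by
      have := Real.one_sub_le_exp_neg (1/4)
      rw [Real.exp_neg] at this
      have hp := Real.exp_pos (1/4)
      have h5 : (3/4) * Real.exp (1/4) ≤ 1 := by
        have := mul_le_mul_of_nonneg_right this hp.le
        rw [inv_mul_cancel₀ hp.ne'] at this
        linarith
      linarith
    rw [e1]
    nlinarith [Real.exp_pos 1, Real.exp_pos (1/4)]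
  push Not at hsmall
  set δ : ℝ := q / dmin with hδ
  have hδ0 : 0 < δ := by positivity
  have hBδ : B / 2 * δ ≤ 1/8 := by
    rw [← hBeq, hδ]
    have : √((dmin : ℝ) / q) * (q / dmin) ≤ 1/2 := by
      set r := √((dmin : ℝ) / q) with hr
      have hrr : r * r = dmin / q := Real.mul_self_sqrt (by positivity)
      have hr2 : 2 ≤ r := by
        apply Real.le_sqrt_of_sq_le
        rw [le_div_iff₀ hq0]; linarith
      have : q / dmin = (r * r)⁻¹ := by rw [hrr, inv_div]
      rw [this, mul_inv, mul_inv_cancel_left₀ (by linarith)]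
      rw [← one_div]
      apply one_div_le_one_div_of_le <;> linarith
    have e : √((dmin : ℝ) / q) / (2 * q) * (q / dmin) =
      (√((dmin : ℝ) / q) * (q / dmin)) / (2 * q) := by ring
    rw [e, div_le_iff₀ (by positivity)]
    nlinarith
  have hKδ : 2 * (K * δ) ≤ 1/8 := by nlinarith
  have hs : p₀ + δ ≤ p₁ := by
    by_contra h
    push Not at h
    have : K * (p₁ - p₀) ≤ K * δ := mul_le_mul_of_nonneg_left (by linarith) hK0
    linarith
  have ms : p₀ + δ ∈ Set.Icc (0:ℝ) 1 := ⟨by linarith, by linarith⟩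
  -- first step
  have hstep : 1 - g p₀ ≤ 2 * (1 - a (p₀ + δ)) := by
    obtain ⟨x, hx, hxe⟩ := exists_hasDerivAt_eq_slope a _ (show p₀ < p₀ + δ by linarith)
      (fun x _ => (pr_deriv (wkReg C) x).continuousAt.continuousWithinAt)
      (fun x _ => pr_deriv (wkReg C) x)
    have mx : x ∈ Set.Icc (0:ℝ) 1 := ⟨by linarith [hx.1], by linarith [hx.2]⟩
    have ht := wk_tie C dmin hdmin mx.1 mx.2
    rw [hxe, add_sub_cancel_left, div_le_iff₀ hδ0] at ht
    have e : -((dmin : ℝ) / q) * (a x - g x) * δ = -(a x - g x) := by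
      rw [hδ]; field_simp
    rw [e] at ht
    have i1 := haanti mx ms hx.2.le
    have i2 := hganti m0 mx hx.1.le
    have i3 := ha1 p₀ m0
    linarith
  have hsub : ∀ x ∈ Set.Icc (p₀ + δ) p₁, x ∈ Set.Icc (0:ℝ) 1 := fun x hx =>
    ⟨by linarith [hx.1], by linarith [hx.2]⟩
  have hode := ode_bound a _ (B/2) (p₀ + δ) p₁ hs (pr_deriv (wkReg C))
    (fun x hx => ha0 x (hsub x hx)) (fun x hx => ha1 x (hsub x hx))
    (haanti.mono hsub) (fun x hx => by
      have := wk_diff C dmin hdmin (hsub x hx).1 (hsub x hx).2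
      rw [← hq, hBeq] at this
      exact this)
  have i1 := hga p₁ m1
  have i2 := ha0 p₁ m1
  have i3 : 0 ≤ 1 - g p₀ := by linarith [hg1 p₀ m0]
  calc g p₁ * (1 - g p₀) ≤ a p₁ * (2 * (1 - a (p₀ + δ))) := by
        apply mul_le_mul i1 hstep i3 i2
    _ = 2 * (a p₁ * (1 - a (p₀ + δ))) := by ring
    _ ≤ Real.exp 1 * Real.exp (-(B/2) * (p₁ - (p₀ + δ))) := by
        apply mul_le_mul _ hode _ (Real.exp_pos _).le
        · linarith [Real.exp_one_gt_d9]
        · exact mul_nonneg i2 (by linarith [ha1 _ ms])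
    _ ≤ _ := by
        rw [← Real.exp_add]
        apply Real.exp_le_exp.mpr
        have : 2 * K * (p₁ - p₀) ≤ B / 2 * (p₁ - p₀) :=
          mul_le_mul_of_nonneg_right hKB (by linarith)
        nlinarith
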